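/- arXiv:1511.03777 — 6 statements merged into one kernel-verified Lean document; each statement's English description precedes it below -/
import Mathlib

section
/- Let a > 0, R > 0, 0 < λ < 1, N ≥ 0, τ̂_L > 0, τ̂_H > 0, μ̂_L, μ̂_H ∈ ℝ, and suppose μ̂_H − μ̂_L > a(1+N)/((1−λ)·τ̂_H) + a·N/(λ·τ̂_L). Set P₁ = P_H = (1/R)(μ̂_H − a(1+N)/((1−λ)·τ̂_H)), y_L = −N/λ, and y_H = (1+N)/(1−λ). Then (P₁, y_L, y_H) is a short-sale-constrained equilibrium: (i) λ·y_L + (1−λ)·y_H = 1; (ii) y_L maximizes f_L(y) = y(μ̂_L − R·P₁) − (a/2)·y²/τ̂_L over {y : λ·y ≥ −N}; and (iii) y_H maximizes f_H(y) = y(μ̂_H − R·P₁) − (a/2)·y²/τ̂_H over {y : (1−λ)·y ≥ −N}. -/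
/-- First-order sufficient condition for a mean-variance objective: `z` does at least as well as
`y` when the derivative at `z` in the direction of `y - z` is nonpositive. -/
lemma meanVariance_le_of_deriv_mul_nonpos {a τ m y z : ℝ} (ha : 0 ≤ a) (hτ : 0 ≤ τ)
    (h : (y - z) * (m - a * z / τ) ≤ 0) :
    y * m - (a / 2) * y ^ 2 / τ ≤ z * m - (a / 2) * z ^ 2 / τ := by
  have hsq : 0 ≤ a / 2 * (y - z) ^ 2 / τ := by positivity
  have hdiff : y * m - (a / 2) * y ^ 2 / τ - (z * m - (a / 2) * z ^ 2 / τ) =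
      (y - z) * (m - a * z / τ) - a / 2 * (y - z) ^ 2 / τ := by ring
  linarith


/-- Case (a) of Proposition 1: under condition (a), the triple
`(P₁, y_L, y_H) = (P_H, −N/λ, (1+N)/(1−λ))` is a short-sale-constrained equilibrium. -/
theorem stmt_5 (a R lam N τL τH μL μH : ℝ) (ha : 0 < a) (hR : 0 < R)
    (hlam0 : 0 < lam) (hlam1 : lam < 1) (hN : 0 ≤ N) (hτL : 0 < τL) (hτH : 0 < τH)
    (hcond : μH - μL > a * (1 + N) / ((1 - lam) * τH) + a * N / (lam * τL)) :
    let P₁ : ℝ := (1 / R) * (μH - a * (1 + N) / ((1 - lam) * τH))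
    let yL : ℝ := -N / lam
    let yH : ℝ := (1 + N) / (1 - lam)
    lam * yL + (1 - lam) * yH = 1 ∧
    (lam * yL ≥ -N ∧ ∀ y : ℝ, lam * y ≥ -N →
      y * (μL - R * P₁) - (a / 2) * y ^ 2 / τL ≤
        yL * (μL - R * P₁) - (a / 2) * yL ^ 2 / τL) ∧
    ((1 - lam) * yH ≥ -N ∧ ∀ y : ℝ, (1 - lam) * y ≥ -N →
      y * (μH - R * P₁) - (a / 2) * y ^ 2 / τH ≤
        yH * (μH - R * P₁) - (a / 2) * yH ^ 2 / τH) := by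
  intro P₁ yL yH
  have hlam' : 0 < 1 - lam := sub_pos.2 hlam1
  have hL : lam * yL = -N := mul_div_cancel₀ _ hlam0.ne'
  have hH : (1 - lam) * yH = 1 + N := mul_div_cancel₀ _ hlam'.ne'
  have hRP : R * P₁ = μH - a * (1 + N) / ((1 - lam) * τH) := by
    simp only [P₁]
    field_simp
  refine ⟨by linarith, ⟨hL.ge, fun y hy => ?_⟩, ⟨by linarith, fun y _ => ?_⟩⟩
  · apply meanVariance_le_of_deriv_mul_nonpos ha.le hτL.le
    have hy' : yL ≤ y := le_of_mul_le_mul_left (hL.trans_le hy) hlam0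
    have hyL : a * yL / τL = -(a * N / (lam * τL)) := by
      simp only [yL]
      field_simp
    exact mul_nonpos_of_nonneg_of_nonpos (sub_nonneg.2 hy') (by linarith)
  · apply meanVariance_le_of_deriv_mul_nonpos ha.le hτH.le
    have hyH : a * yH / τH = a * (1 + N) / ((1 - lam) * τH) := by
      simp only [yH]
      field_simp
    have hfoc : μH - R * P₁ - a * yH / τH = 0 := by linarith
    rw [hfoc, mul_zero]
end

section
/- Let a > 0, R > 0, 0 < λ < 1, N ≥ 0, τ̂_L > 0, τ̂_H > 0, μ̂_L, μ̂_H ∈ ℝ, and suppose μ̂_L − μ̂_H > a(1+N)/(λ·τ̂_L) + a·N/((1−λ)·τ̂_H). Set P₁ = P_L = (1/R)(μ̂_L − a(1+N)/(λ·τ̂_L)), y_L = (1+N)/λ, and y_H = −N/(1−λ). Then (P₁, y_L, y_H) is a short-sale-constrained equilibrium: (i) λ·y_L + (1−λ)·y_H = 1; (ii) y_L maximizes f_L(y) = y(μ̂_L − R·P₁) − (a/2)·y²/τ̂_L over {y : λ·y ≥ −N}; and (iii) y_H maximizes f_H(y) = y(μ̂_H − R·P₁) − (a/2)·y²/τ̂_H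 over {y : (1−λ)·y ≥ −N}. -/
/-- First-order sufficiency for a concave quadratic objective: if moving from `y₀` to `y` does not
increase the objective to first order, then it does not increase it. -/
theorem mean_variance_le_of_first_order {a τ c y₀ y : ℝ} (ha : 0 ≤ a) (hτ : 0 ≤ τ)
    (h : (y - y₀) * (c - a * y₀ / τ) ≤ 0) :
    y * c - (a / 2) * y ^ 2 / τ ≤ y₀ * c - (a / 2) * y₀ ^ 2 / τ := by
  have hsq : 0 ≤ a / 2 / τ * (y - y₀) ^ 2 := by positivity
  have hid : y₀ * c - (a / 2) * y₀ ^ 2 / τ - (y * c - (a / 2) * y ^ 2 / τ) =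
      a / 2 / τ * (y - y₀) ^ 2 - (y - y₀) * (c - a * y₀ / τ) := by
    ring
  linarith


/-- Case (b) of Proposition 1: under condition (b), the triple
`(P₁, y_L, y_H) = (P_L, (1+N)/λ, −N/(1−λ))` is a short-sale-constrained equilibrium. -/
theorem stmt_6 (a R lam N τL τH μL μH : ℝ) (ha : 0 < a) (hR : 0 < R)
    (hlam0 : 0 < lam) (hlam1 : lam < 1) (hN : 0 ≤ N) (hτL : 0 < τL) (hτH : 0 < τH)
    (hcond : μL - μH > a * (1 + N) / (lam * τL) + a * N / ((1 - lam) * τH)) :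
    let P₁ : ℝ := (1 / R) * (μL - a * (1 + N) / (lam * τL))
    let yL : ℝ := (1 + N) / lam
    let yH : ℝ := -N / (1 - lam)
    lam * yL + (1 - lam) * yH = 1 ∧
    (lam * yL ≥ -N ∧ ∀ y : ℝ, lam * y ≥ -N →
      y * (μL - R * P₁) - (a / 2) * y ^ 2 / τL ≤
        yL * (μL - R * P₁) - (a / 2) * yL ^ 2 / τL) ∧
    ((1 - lam) * yH ≥ -N ∧ ∀ y : ℝ, (1 - lam) * y ≥ -N →
      y * (μH - R * P₁) - (a / 2) * y ^ 2 / τH ≤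
        yH * (μH - R * P₁) - (a / 2) * yH ^ 2 / τH) := by
  intro P₁ yL yH
  have hlam : 0 < 1 - lam := sub_pos.mpr hlam1
  have hL : lam * yL = 1 + N := mul_div_cancel₀ _ hlam0.ne'
  have hH : (1 - lam) * yH = -N := mul_div_cancel₀ _ hlam.ne'
  have hP : R * P₁ = μL - a * (1 + N) / (lam * τL) := by
    simp only [P₁]
    field_simp
  have hyL : a * yL / τL = a * (1 + N) / (lam * τL) := by
    simp only [yL]
    field_simp
  have hyH : a * yH / τH = -(a * N / ((1 - lam) * τH)) := by
    simp only [yH]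
    field_simp
  refine ⟨by linarith, ⟨by linarith, fun y _ => ?_⟩, ⟨hH.ge, fun y hy => ?_⟩⟩
  · apply mean_variance_le_of_first_order ha.le hτL.le
    rw [hP, hyL, sub_sub_cancel, sub_self, mul_zero]
  · apply mean_variance_le_of_first_order ha.le hτH.le
    have hle : yH ≤ y := le_of_mul_le_mul_left (hH.trans_le hy) hlam
    exact mul_nonpos_of_nonneg_of_nonpos (sub_nonneg.mpr hle) (by rw [hP, hyH]; linarith)
end

section
/- Let a > 0, R > 0, 0 < λ < 1, N ≥ 0, τ̂_L > 0, τ̂_H > 0, μ̂_L, μ̂_H ∈ ℝ. Suppose neither μ̂_H − μ̂_L > a(1+N)/((1−λ)·τ̂_H) + a·N/(λ·τ̂_L) nor μ̂_L − μ̂_H > a(1+N)/(λ·τ̂_L) + a·N/((1−λ)·τ̂_H) holds. Set P₁ = (λ·τ̂_L·μ̂_L + (1−λ)·τ̂_H·μ̂_H − a) / (R·(λ·τ̂_L + (1−λ)·τ̂_H)), y_L = ((1/a)(1−λ)·τ̂_L·τ̂_H·(μ̂_L − μ̂_H) + τ̂_L) / (λ·τ̂_L + (1−λ)·τ̂_H),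 and y_H = ((1/a)·λ·τ̂_L·τ̂_H·(μ̂_H − μ̂_L) + τ̂_H) / (λ·τ̂_L + (1−λ)·τ̂_H). Then (P₁, y_L, y_H) is a short-sale-constrained equilibrium: (i) λ·y_L + (1−λ)·y_H = 1; (ii) y_L maximizes f_L(y) = y(μ̂_L − R·P₁) − (a/2)·y²/τ̂_L over {y : λ·y ≥ −N}; and (iii) y_H maximizes f_H(y) = y(μ̂_H − R·P₁) − (a/2)·y²/τ̂_H over {y : (1−λ)·y ≥ −N}. -/
/-- A mean-variance objective is maximized at any point satisfying its first-order condition. -/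
lemma meanVariance_le_of_firstOrder {a τ m x : ℝ} (ha : 0 < a) (hτ : 0 < τ)
    (hm : m = a * x / τ) (y : ℝ) :
    y * m - (a / 2) * y ^ 2 / τ ≤ x * m - (a / 2) * x ^ 2 / τ := by
  have h : x * m - (a / 2) * x ^ 2 / τ - (y * m - (a / 2) * y ^ 2 / τ) =
      a / 2 * (x - y) ^ 2 / τ := by
    rw [hm]
    field_simp
    ring
  have : 0 ≤ a / 2 * (x - y) ^ 2 / τ := by positivity
  linarith

/-- If the disagreement `d` is at most the short-sale threshold, the aggregate interior position
of the less optimistic type, with aggregate precisions `A` and `B`, is at least `-N`. -/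
lemma neg_le_interior_position {a A B N d : ℝ} (ha : 0 < a) (hA : 0 < A) (hB : 0 < B)
    (hd : d ≤ a * (1 + N) / B + a * N / A) :
    -N ≤ (A - A * B * d / a) / (A + B) := by
  have h : A * B / a * d ≤ A * (1 + N) + B * N := by
    calc A * B / a * d ≤ A * B / a * (a * (1 + N) / B + a * N / A) := by gcongr
      _ = A * (1 + N) + B * N := by field_simp
  rw [le_div_iff₀ (by positivity), mul_div_right_comm]
  linarith


/-- Case (c) of Proposition 1: when neither condition (a) nor (b) holds, the interior
triple `(P₁, y_L, y_H)` is a short-sale-constrained equilibrium. -/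
theorem stmt_7 (a R lam N τL τH μL μH : ℝ) (ha : 0 < a) (hR : 0 < R)
    (hlam0 : 0 < lam) (hlam1 : lam < 1) (hN : 0 ≤ N) (hτL : 0 < τL) (hτH : 0 < τH)
    (hnota : ¬ (μH - μL > a * (1 + N) / ((1 - lam) * τH) + a * N / (lam * τL)))
    (hnotb : ¬ (μL - μH > a * (1 + N) / (lam * τL) + a * N / ((1 - lam) * τH))) :
    let P₁ : ℝ := (lam * τL * μL + (1 - lam) * τH * μH - a) /
      (R * (lam * τL + (1 - lam) * τH))
    let yL : ℝ := ((1 / a) * (1 - lam) * τL * τH * (μL - μH) + τL) /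
      (lam * τL + (1 - lam) * τH)
    let yH : ℝ := ((1 / a) * lam * τL * τH * (μH - μL) + τH) /
      (lam * τL + (1 - lam) * τH)
    lam * yL + (1 - lam) * yH = 1 ∧
    (lam * yL ≥ -N ∧ ∀ y : ℝ, lam * y ≥ -N →
      y * (μL - R * P₁) - (a / 2) * y ^ 2 / τL ≤
        yL * (μL - R * P₁) - (a / 2) * yL ^ 2 / τL) ∧
    ((1 - lam) * yH ≥ -N ∧ ∀ y : ℝ, (1 - lam) * y ≥ -N →
      y * (μH - R * P₁) - (a / 2) * y ^ 2 / τH ≤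
        yH * (μH - R * P₁) - (a / 2) * yH ^ 2 / τH) := by
  intro P₁ yL yH
  have hlam : 0 < 1 - lam := sub_pos.mpr hlam1
  have hA : 0 < lam * τL := mul_pos hlam0 hτL
  have hB : 0 < (1 - lam) * τH := mul_pos hlam hτH
  have hD : lam * τL + (1 - lam) * τH ≠ 0 := (add_pos hA hB).ne'
  have hL : μL - R * P₁ = a * yL / τL := by
    simp only [P₁, yL]
    field_simp
    ring
  have hH : μH - R * P₁ = a * yH / τH := by
    simp only [P₁, yH]
    field_simp
    ring
  refine ⟨?_, ⟨?_, fun y _ => meanVariance_le_of_firstOrder ha hτL hL y⟩,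
    ?_, fun y _ => meanVariance_le_of_firstOrder ha hτH hH y⟩
  · simp only [yL, yH]
    field_simp
    ring
  · refine (neg_le_interior_position ha hA hB (not_lt.mp hnota)).trans_eq ?_
    simp only [yL]
    field_simp
    ring
  · refine (neg_le_interior_position ha hB hA (not_lt.mp hnotb)).trans_eq ?_
    rw [add_comm ((1 - lam) * τH)]
    simp only [yH]
    field_simp
    ring
end

section
/- Let a > 0, 0 < λ < 1, N ≥ 0, τ̂_L > 0, τ̂_H > 0, μ̂_L, μ̂_H ∈ ℝ. Define y_L = ((1/a)(1−λ)·τ̂_L·τ̂_H·(μ̂_L − μ̂_H) + τ̂_L) / (λ·τ̂_L + (1−λ)·τ̂_H) and y_H = ((1/a)·λ·τ̂_L·τ̂_H·(μ̂_H − μ̂_L) + τ̂_H) / (λ·τ̂_L + (1−λ)·τ̂_H). Then: (i) λ·y_L + (1−λ)·y_H = 1 always; (ii) if μ̂_H − μ̂_L ≤ a(1+N)/((1−λ)·τ̂_H) + a·N/(λ·τ̂_L), then λ·y_L ≥ −N; and (iii) if μ̂_L − μ̂_H ≤ a(1+N)/(λ·τ̂_L) + a·N/((1−λ)·τ̂_H),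 then (1−λ)·y_H ≥ −N. -/
/-- With precision weights `p`, `q`, the short-sale cap `N` holds whenever the valuation gap `d` is
below the crowding-out threshold. -/
theorem neg_le_weighted_demand {a p q N d : ℝ} (ha : 0 < a) (hp : 0 < p) (hq : 0 < q)
    (h : d ≤ a * (1 + N) / q + a * N / p) :
    -N ≤ (p - p * q * d / a) / (p + q) := by
  have hgap : p * q * d / a ≤ p * (1 + N) + q * N := by
    calc p * q * d / a ≤ p * q * (a * (1 + N) / q + a * N / p) / a := by gcongr
      _ = p * (1 + N) + q * N := by field_simp
  rw [le_div_iff₀ (by positivity)]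
  linarith

/-- The interior demands of case (c) of Proposition 1 clear the market, and they are
feasible for each type exactly when the corresponding crowding-out condition fails. -/
theorem stmt_8 (a lam N τL τH μL μH : ℝ) (ha : 0 < a) (hlam0 : 0 < lam)
    (hlam1 : lam < 1) (hN : 0 ≤ N) (hτL : 0 < τL) (hτH : 0 < τH) :
    let yL : ℝ := ((1 / a) * (1 - lam) * τL * τH * (μL - μH) + τL) /
      (lam * τL + (1 - lam) * τH)
    let yH : ℝ := ((1 / a) * lam * τL * τH * (μH - μL) + τH) /
      (lam * τL + (1 - lam) * τH)
    lam * yL + (1 - lam) * yH = 1 ∧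
    (μH - μL ≤ a * (1 + N) / ((1 - lam) * τH) + a * N / (lam * τL) →
      lam * yL ≥ -N) ∧
    (μL - μH ≤ a * (1 + N) / (lam * τL) + a * N / ((1 - lam) * τH) →
      (1 - lam) * yH ≥ -N) := by
  intro yL yH
  have hp : 0 < lam * τL := mul_pos hlam0 hτL
  have hq : 0 < (1 - lam) * τH := mul_pos (sub_pos.mpr hlam1) hτH
  have hpq : lam * τL + (1 - lam) * τH ≠ 0 := (add_pos hp hq).ne'
  refine ⟨?_, fun h => ?_, fun h => ?_⟩
  · simp only [yL, yH]
    rw [← mul_div_assoc, ← mul_div_assoc, ← add_div, div_eq_one_iff_eq hpq]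
    ring
  · refine (neg_le_weighted_demand ha hp hq h).trans_eq ?_
    simp only [yL]
    ring
  · refine (neg_le_weighted_demand ha hq hp h).trans_eq ?_
    simp only [yH]
    rw [add_comm ((1 - lam) * τH) (lam * τL)]
    ring
end

section
/- Let a > 0, R > 0, 0 < λ < 1, N ≥ 0, τ̂_L > 0, μ̂_L ∈ ℝ, and let P_H ∈ ℝ be any price. If the unconstrained type-L optimum y*_L = (μ̂_L − R·P_H)·τ̂_L / a satisfies λ·y*_L < −N, then the maximizer of f_L(y) = y(μ̂_L − R·P_H) − (a/2)·y²/τ̂_L over {y : λ·y ≥ −N} is y = −N/λ. In particular, under condition μ̂_H − μ̂_L > a(1+N)/((1−λ)·τ̂_H) + a·N/(λ·τ̂_L) with P_H = (1/R)(μ̂_H − a(1+N)/((1−λ)·τ̂_H)) and τ̂_H > 0, μ̂_H ∈ ℝ, one has λ·y*_L < −N, so the short-sale constraint of type-L investors binds at the equilibrium price P_H. -/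
/-- A concave quadratic with vertex `m * τ / a` is antitone to the right of its vertex. -/
lemma quadratic_le_of_vertex_le {a τ m k y : ℝ} (ha : 0 < a) (hτ : 0 < τ)
    (hk : m * τ / a ≤ k) (hy : k ≤ y) :
    y * m - (a / 2) * y ^ 2 / τ ≤ k * m - (a / 2) * k ^ 2 / τ := by
  have key : (k * m - (a / 2) * k ^ 2 / τ) - (y * m - (a / 2) * y ^ 2 / τ) =
      a / (2 * τ) * ((y - k) * ((y - m * τ / a) + (k - m * τ / a))) := by
    field_simp
    ring
  have hnonneg : 0 ≤ a / (2 * τ) * ((y - k) * ((y - m * τ / a) + (k - m * τ / a))) :=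
    mul_nonneg (by positivity) (mul_nonneg (by linarith) (by linarith))
  linarith

/-- If the unconstrained type-L optimum violates the short-sale constraint, the
constrained maximizer is the boundary point `−N/λ`; in particular, under condition (a)
of Proposition 1 at the price `P_H`, the type-L short-sale constraint binds. -/
theorem stmt_9 (a R lam N τL μL : ℝ) (ha : 0 < a) (hR : 0 < R)
    (hlam0 : 0 < lam) (hlam1 : lam < 1) (hN : 0 ≤ N) (hτL : 0 < τL) :
    (∀ PH : ℝ, lam * ((μL - R * PH) * τL / a) < -N →
      ∀ y : ℝ, lam * y ≥ -N →
        y * (μL - R * PH) - (a / 2) * y ^ 2 / τL ≤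
          (-N / lam) * (μL - R * PH) - (a / 2) * (-N / lam) ^ 2 / τL) ∧
    (∀ τH μH : ℝ, 0 < τH →
      μH - μL > a * (1 + N) / ((1 - lam) * τH) + a * N / (lam * τL) →
      lam * ((μL - R * ((1 / R) * (μH - a * (1 + N) / ((1 - lam) * τH)))) * τL / a)
        < -N) := by
  refine ⟨fun PH hPH y hy => ?_, fun τH μH _ h => ?_⟩
  · refine quadratic_le_of_vertex_le ha hτL ?_ ?_
    · rw [le_div_iff₀ hlam0]
      linarith
    · rw [div_le_iff₀ hlam0]
      linarith
  · have hprice : R * ((1 / R) * (μH - a * (1 + N) / ((1 - lam) * τH))) =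
        μH - a * (1 + N) / ((1 - lam) * τH) := by
      field_simp
    rw [hprice]
    have hlt : μL - (μH - a * (1 + N) / ((1 - lam) * τH)) < -(a * N / (lam * τL)) := by
      linarith
    calc lam * ((μL - (μH - a * (1 + N) / ((1 - lam) * τH))) * τL / a)
        < lam * (-(a * N / (lam * τL)) * τL / a) := by gcongr
      _ = -N := by field_simp
end

section
/- Let a > 0, R > 0, 0 < λ < 1, τ̂_L > 0, τ̂_H > 0, μ̂_L, μ̂_H ∈ ℝ. Define G(N) = P_H(N) − P_s(N) where P_H(N) = (1/R)(μ̂_H − a(1+N)/((1−λ)·τ̂_H)) and P_s(N) = (1/R)(μ̂_L + a·N/(λ·τ̂_L)). Then G is strictly decreasing on [0, ∞), and G(N) > 0 if and only if μ̂_H − μ̂_L > a(1+N)/((1−λ)·τ̂_H) + a·N/(λ·τ̂_L). Consequently, if μ̂_H > μ̂_L + a/((1−λ)·τ̂_H), there is a unique N* > 0 with G(N*) = 0, namely N* = (μ̂_H − μ̂_L − a/((1−λ)·τ̂_H)) / (a/((1−λ)·τ̂_H) + a/(λ·τ̂_L)), and the liquidity vacuum G(N) > 0 exists exactly for N < N*.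 -/
/-- The liquidity-vacuum gap `G(N) = P_H(N) − P_s(N)` is strictly decreasing on `[0,∞)`,
is positive iff condition (a) of Proposition 1 holds, and—when `μ̂_H > μ̂_L + a/((1−λ)τ̂_H)`—
vanishes at the unique critical cap `N* > 0`, with `G(N) > 0` exactly for `N < N*`. -/
theorem stmt_13 (a R lam τL τH μL μH : ℝ) (ha : 0 < a) (hR : 0 < R)
    (hlam0 : 0 < lam) (hlam1 : lam < 1) (hτL : 0 < τL) (hτH : 0 < τH) :
    let G : ℝ → ℝ := fun N =>
      (1 / R) * (μH - a * (1 + N) / ((1 - lam) * τH)) -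
        (1 / R) * (μL + a * N / (lam * τL))
    StrictAntiOn G (Set.Ici (0 : ℝ)) ∧
    (∀ N : ℝ, 0 ≤ N →
      (G N > 0 ↔
        μH - μL > a * (1 + N) / ((1 - lam) * τH) + a * N / (lam * τL))) ∧
    (μH > μL + a / ((1 - lam) * τH) →
      let Nstar : ℝ := (μH - μL - a / ((1 - lam) * τH)) /
        (a / ((1 - lam) * τH) + a / (lam * τL))
      0 < Nstar ∧ G Nstar = 0 ∧ (∀ N : ℝ, 0 < N → G N = 0 → N = Nstar) ∧
        ∀ N : ℝ, 0 ≤ N → (G N > 0 ↔ N < Nstar)) := by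
  intro G
  have hA : 0 < a / ((1 - lam) * τH) := div_pos ha (mul_pos (sub_pos.2 hlam1) hτH)
  have hB : 0 < a / (lam * τL) := div_pos ha (mul_pos hlam0 hτL)
  have hR' : 0 < 1 / R := one_div_pos.2 hR
  have hG : ∀ N, G N = (1 / R) * ((μH - μL - a / ((1 - lam) * τH)) -
      N * (a / ((1 - lam) * τH) + a / (lam * τL))) := fun N => by
    simp only [G]
    ring
  have hS := add_pos hA hB
  refine ⟨fun x _ y _ hxy => ?_, fun N _ => ?_, fun hμ => ?_⟩
  · rw [hG, hG]
    gcongr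
  · have hN : a * (1 + N) / ((1 - lam) * τH) + a * N / (lam * τL) =
        a / ((1 - lam) * τH) + N * (a / ((1 - lam) * τH) + a / (lam * τL)) := by ring
    rw [hG, hN, gt_iff_lt, mul_pos_iff_of_pos_left hR']
    constructor <;> intro h <;> linarith
  · intro Nstar
    refine ⟨div_pos (by linarith) hS, ?_, fun N _ h => ?_, fun N _ => ?_⟩
    · rw [hG, div_mul_cancel₀ _ hS.ne', sub_self, mul_zero]
    · rw [hG, mul_eq_zero, or_iff_right hR'.ne', sub_eq_zero] at h
      exact eq_div_of_mul_eq hS.ne' h.symm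
    · rw [hG, gt_iff_lt, mul_pos_iff_of_pos_left hR', sub_pos, lt_div_iff₀ hS]
end
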